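/- Let Y be an integrable real random variable that is symmetric about the origin and whose characteristic function φ_Y is integrable on ℝ. Let α ∈ (1/2, 1) and let a ∈ ℝ satisfy P(Y ≤ a) = α. Then (1/(1−α)) E[Y · 1_{Y ≥ a}] = lim_{b→∞} (1/(π(1−α))) ∫₀^∞ ((bs·sin(bs) + cos(bs) − as·sin(as) − cos(as))/s²) φ_Y(s) ds. -/

import Mathlib

open MeasureTheory Complex Filter

open scoped FourierTransform SchwartzMap

/-- Integrating a Schwartz function against a finite measure amounts to integrating its Fourier
transform against the characteristic function of the measure. -/
theorem SchwartzMap.integral_eq_integral_fourier_mul_charFun (ν : Measure ℝ) [IsFiniteMeasure ν]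
    (g : 𝓢(ℝ, ℂ)) :
    ∫ x, g x ∂ν = ∫ t, 𝓕 (g : ℝ → ℂ) t * charFun ν (2 * Real.pi * t) := by
  have hFg : Integrable (𝓕 (g : ℝ → ℂ)) := by
    rw [← SchwartzMap.fourier_coe]
    exact (𝓕 g).integrable
  have hflip := VectorFourier.integral_fourierIntegral_smul_eq_flip (μ := volume) (ν := ν)
    (L := -(LinearMap.mul ℝ ℝ)) (f := 𝓕 (g : ℝ → ℂ)) (g := fun _ => (1 : ℂ))
    Real.continuous_fourierChar (by simp only [LinearMap.neg_apply, LinearMap.mul_apply']; fun_prop)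
    hFg (integrable_const _)
  calc ∫ x, g x ∂ν = ∫ x, VectorFourier.fourierIntegral 𝐞 volume (-(LinearMap.mul ℝ ℝ))
          (𝓕 (g : ℝ → ℂ)) x • (1 : ℂ) ∂ν := by
        refine integral_congr_ae (ae_of_all _ fun x => ?_)
        have hinv := congrFun (g.continuous.fourierInv_fourier_eq g.integrable hFg) x
        rw [Real.fourierInv_eq] at hinv
        simp only [smul_eq_mul, mul_one]
        rw [← hinv, VectorFourier.fourierIntegral]
        simp [mul_comm]
    _ = _ := hflip
    _ = _ := by
        refine integral_congr_ae (ae_of_all _ fun t => ?_)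
        simp only [smul_eq_mul, VectorFourier.fourierIntegral, charFun_apply_real]
        congr 1
        refine integral_congr_ae (ae_of_all _ fun x => ?_)
        simp only [LinearMap.flip_apply, LinearMap.neg_apply, LinearMap.mul_apply', neg_neg,
          Circle.smul_def, Real.fourierChar_apply, smul_eq_mul, mul_one]
        congr 1
        push_cast
        ring

/-- A smooth function truncated to a compact interval is a bounded pointwise limit of Schwartz
functions supported in a common compact interval. -/
theorem exists_schwartzMap_tendsto_indicator_Icc {p : ℝ → ℂ} (hp : ContDiff ℝ (⊤ : ℕ∞) p)
    {a b : ℝ} (hab : a < b) :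
    ∃ (g : ℕ → 𝓢(ℝ, ℂ)) (C : ℝ),
      (∀ n x, ‖g n x‖ ≤ (Set.Icc (a - 1) (b + 1)).indicator (fun _ => C) x) ∧
      ∀ x, Tendsto (fun n => g n x) atTop (nhds ((Set.Icc a b).indicator p x)) := by
  let f : ℕ → ContDiffBump ((a + b) / 2) := fun n =>
    ⟨(b - a) / 2, (b - a) / 2 + 1 / ((n : ℝ) + 1), by linarith,
      by have : (0 : ℝ) < 1 / ((n : ℝ) + 1) := by positivity
         linarith⟩
  have hsupp : ∀ n, HasCompactSupport (fun x => (f n x : ℂ) * p x) := fun n =>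
    ((f n).hasCompactSupport.comp_left (g := ((↑) : ℝ → ℂ)) Complex.ofReal_zero).mul_right
  have hsmooth : ∀ n, ContDiff ℝ (⊤ : ℕ∞) (fun x => (f n x : ℂ) * p x) := fun n =>
    (Complex.ofRealCLM.contDiff.comp (f n).contDiff).mul hp
  obtain ⟨C, hC⟩ := isCompact_Icc.exists_bound_of_continuousOn
    (hp.continuous.continuousOn (s := Set.Icc (a - 1) (b + 1)))
  refine ⟨fun n => (hsupp n).toSchwartzMap (hsmooth n), C, fun n x => ?_, fun x => ?_⟩
  · change ‖(f n x : ℂ) * p x‖ ≤ _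
    have hn : 1 / ((n : ℝ) + 1) ≤ 1 := by
      rw [div_le_one (by positivity)]
      linarith [n.cast_nonneg (α := ℝ)]
    by_cases hx : x ∈ Set.Icc (a - 1) (b + 1)
    · rw [Set.indicator_of_mem hx, norm_mul, Complex.norm_real, Real.norm_of_nonneg (f n).nonneg]
      exact (mul_le_of_le_one_left (norm_nonneg _) (f n).le_one).trans (hC x hx)
    · rw [Set.indicator_of_notMem hx, (f n).zero_of_le_dist]
      · simp
      · change (b - a) / 2 + 1 / ((n : ℝ) + 1) ≤ |x - (a + b) / 2|
        by_contra! hlt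
        rw [abs_lt] at hlt
        exact hx ⟨by linarith, by linarith⟩
  · change Tendsto (fun n => (f n x : ℂ) * p x) atTop _
    by_cases hx : x ∈ Set.Icc a b
    · have hone : ∀ n, f n x = 1 := fun n => (f n).one_of_mem_closedBall <| by
        change |x - (a + b) / 2| ≤ (b - a) / 2
        exact abs_le.2 ⟨by linarith [hx.1], by linarith [hx.2]⟩
      simp [hone, Set.indicator_of_mem hx]
    · rw [Set.indicator_of_notMem hx]
      have hpos : 0 < |x - (a + b) / 2| - (b - a) / 2 := by
        by_contra! hle
        have hle' : |x - (a + b) / 2| ≤ (b - a) / 2 := by linarith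
        rw [abs_le] at hle'
        exact hx ⟨by linarith, by linarith⟩
      refine tendsto_const_nhds.congr' ?_
      filter_upwards [(tendsto_one_div_add_atTop_nhds_zero_nat (𝕜 := ℝ)).eventually_lt_const hpos]
        with n hn
      rw [(f n).zero_of_le_dist]
      · simp
      · change (b - a) / 2 + 1 / ((n : ℝ) + 1) ≤ |x - (a + b) / 2|
        linarith

/-- Fourier inversion for a smooth function truncated to a compact interval, integrated against a
finite measure with integrable characteristic function. -/
theorem setIntegral_Icc_eq_integral_fourier_mul_charFun (ν : Measure ℝ) [IsFiniteMeasure ν]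
    (hν : Integrable (charFun ν)) {p : ℝ → ℂ} (hp : ContDiff ℝ (⊤ : ℕ∞) p) {a b : ℝ}
    (hab : a < b) :
    ∫ x in Set.Icc a b, p x ∂ν =
      ∫ t, 𝓕 ((Set.Icc a b).indicator p) t * charFun ν (2 * Real.pi * t) := by
  obtain ⟨g, C, hbound, hlim⟩ := exists_schwartzMap_tendsto_indicator_Icc hp hab
  have hind : ∀ m : Measure ℝ, [IsFiniteMeasureOnCompacts m] →
      Integrable ((Set.Icc (a - 1) (b + 1)).indicator fun _ => C) m := fun m _ =>
    (integrable_indicator_iff measurableSet_Icc).2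
      (integrableOn_const isCompact_Icc.measure_ne_top)
  have hleft : Tendsto (fun n => ∫ x, g n x ∂ν) atTop
      (nhds (∫ x, (Set.Icc a b).indicator p x ∂ν)) :=
    tendsto_integral_of_dominated_convergence _
      (fun n => (g n).continuous.aestronglyMeasurable) (hind ν)
      (fun n => ae_of_all _ (hbound n)) (ae_of_all _ hlim)
  have hright : Tendsto (fun n => ∫ x, g n x ∂ν) atTop
      (nhds (∫ t, 𝓕 ((Set.Icc a b).indicator p) t * charFun ν (2 * Real.pi * t))) := by
    simp_rw [SchwartzMap.integral_eq_integral_fourier_mul_charFun]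
    have hchar : Integrable fun t => charFun ν (2 * Real.pi * t) :=
      hν.comp_mul_left' (by positivity)
    refine tendsto_integral_of_dominated_convergence
      (fun t => (∫ x, (Set.Icc (a - 1) (b + 1)).indicator (fun _ => C) x) *
        ‖charFun ν (2 * Real.pi * t)‖) (fun n => ?_) (hchar.norm.const_mul _)
      (fun n => ae_of_all _ fun t => ?_) (ae_of_all _ fun t => ?_)
    · rw [← SchwartzMap.fourier_coe]
      exact (𝓕 (g n)).continuous.aestronglyMeasurable.mul hchar.aestronglyMeasurable
    · rw [norm_mul]
      gcongr
      rw [Real.fourier_real_eq]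
      refine norm_integral_le_of_norm_le (hind volume) (ae_of_all _ fun x => ?_)
      rw [Circle.norm_smul]
      exact hbound n x
    · refine Tendsto.mul_const _ ?_
      simp_rw [Real.fourier_real_eq]
      refine tendsto_integral_of_dominated_convergence _ (fun n => ?_) (hind volume)
        (fun n => ae_of_all _ fun x => ?_) (ae_of_all _ fun x => (hlim x).const_smul _)
      · simp only [Circle.smul_def, smul_eq_mul]
        exact (((continuous_subtype_val.comp Real.continuous_fourierChar).comp
          (by fun_prop)).mul (g n).continuous).aestronglyMeasurable
      · rw [Circle.norm_smul]
        exact hbound n x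
  rw [← integral_indicator measurableSet_Icc]
  exact tendsto_nhds_unique hleft hright

theorem intervalIntegral_mul_cos {s : ℝ} (hs : s ≠ 0) (a b : ℝ) :
    ∫ x in a..b, x * Real.cos (s * x) =
      (b * s * Real.sin (b * s) + Real.cos (b * s)
        - a * s * Real.sin (a * s) - Real.cos (a * s)) / s ^ 2 := by
  have hderiv : ∀ x ∈ Set.uIcc a b, HasDerivAt
      (fun x => x * (Real.sin (s * x) / s) + Real.cos (s * x) / s ^ 2)
      (x * Real.cos (s * x)) x := fun x _ => by
    have hlin : HasDerivAt (fun x => s * x) s x := by simpa using (hasDerivAt_id x).const_mul s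
    refine (((hasDerivAt_id' x).mul (hlin.sin.div_const s)).add
      (hlin.cos.div_const (s ^ 2))).congr_deriv ?_
    field_simp
    ring
  rw [intervalIntegral.integral_eq_sub_of_hasDerivAt hderiv
    (Continuous.intervalIntegrable (by fun_prop) _ _), mul_comm s a, mul_comm s b]
  field_simp
  ring

theorem fourier_indicator_Icc_add_neg {a b : ℝ} (hab : a ≤ b) {t : ℝ} (ht : t ≠ 0) :
    𝓕 ((Set.Icc a b).indicator fun x : ℝ => (x : ℂ)) t +
        𝓕 ((Set.Icc a b).indicator fun x : ℝ => (x : ℂ)) (-t) =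
      2 * (((b * (2 * Real.pi * t) * Real.sin (b * (2 * Real.pi * t))
        + Real.cos (b * (2 * Real.pi * t)) - a * (2 * Real.pi * t) * Real.sin (a * (2 * Real.pi * t))
        - Real.cos (a * (2 * Real.pi * t))) / (2 * Real.pi * t) ^ 2 : ℝ) : ℂ) := by
  have hint : ∀ u : ℝ, Integrable fun x =>
      Complex.exp ((-2 * Real.pi * x * u : ℝ) * Complex.I) •
        (Set.Icc a b).indicator (fun x : ℝ => (x : ℂ)) x := fun u => by
    have hcont : Continuous fun x : ℝ =>
        Complex.exp ((-2 * Real.pi * x * u : ℝ) * Complex.I) * (x : ℂ) := by fun_prop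
    refine ((integrable_indicator_iff measurableSet_Icc).2
      (hcont.integrableOn_Icc (a := a) (b := b))).congr (ae_of_all _ fun x => ?_)
    simp [Set.indicator_apply]
  rw [← intervalIntegral_mul_cos (by positivity), Real.fourier_real_eq_integral_exp_smul,
    Real.fourier_real_eq_integral_exp_smul, ← integral_add (hint t) (hint (-t)),
    ← intervalIntegral.integral_ofReal, intervalIntegral.integral_of_le hab,
    ← integral_Icc_eq_integral_Ioc, ← integral_const_mul, ← integral_indicator measurableSet_Icc]
  refine integral_congr_ae (ae_of_all _ fun x => ?_)
  by_cases hx : x ∈ Set.Icc a b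
  · simp only [Set.indicator_of_mem hx, smul_eq_mul]
    rw [← add_mul]
    push_cast
    rw [show (2 : ℂ) * (x * Complex.cos (2 * Real.pi * t * x)) =
      2 * Complex.cos (2 * Real.pi * t * x) * x by ring, Complex.two_cos, add_comm]
    congr 3 <;> ring_nf
  · simp [Set.indicator_of_notMem hx]

/-- Partial first moments of a symmetric law with integrable characteristic function. -/
theorem setIntegral_Icc_id_eq_integral_charFun (ν : Measure ℝ) [IsFiniteMeasure ν]
    (hν : Integrable (charFun ν)) (heven : ∀ s, charFun ν (-s) = charFun ν s) {a b : ℝ}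
    (hab : a < b) :
    ((∫ x in Set.Icc a b, x ∂ν : ℝ) : ℂ) = (1 / Real.pi : ℂ) * ∫ s in Set.Ioi (0 : ℝ),
      (((b * s * Real.sin (b * s) + Real.cos (b * s)
          - a * s * Real.sin (a * s) - Real.cos (a * s)) / s ^ 2 : ℝ) : ℂ) * charFun ν s := by
  set K : ℝ → ℂ := fun s => (((b * s * Real.sin (b * s) + Real.cos (b * s)
    - a * s * Real.sin (a * s) - Real.cos (a * s)) / s ^ 2 : ℝ) : ℂ) * charFun ν s with hK
  set h : ℝ → ℂ := (Set.Icc a b).indicator fun x : ℝ => (x : ℂ) with hh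
  set F : ℝ → ℂ := fun t => 𝓕 h t * charFun ν (2 * Real.pi * t) with hF
  have hhint : Integrable h := (integrable_indicator_iff measurableSet_Icc).2
    (Complex.continuous_ofReal.integrableOn_Icc)
  have hFint : Integrable F := by
    refine (hν.comp_mul_left' (by positivity : 2 * Real.pi ≠ 0)).bdd_mul (c := ∫ x, ‖h x‖)
      ?_ (ae_of_all _ fun t => ?_)
    · exact (VectorFourier.fourierIntegral_continuous Real.continuous_fourierChar
        (by fun_prop) hhint).aestronglyMeasurable
    · exact VectorFourier.norm_fourierIntegral_le_integral_norm _ _ _ _ _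
  have hp : ContDiff ℝ (⊤ : ℕ∞) fun x : ℝ => (x : ℂ) := Complex.ofRealCLM.contDiff
  rw [← integral_complex_ofReal, setIntegral_Icc_eq_integral_fourier_mul_charFun ν hν hp hab]
  change ∫ t, F t = _
  have hneg : ∫ t in Set.Iic (0 : ℝ), F t = ∫ t in Set.Ioi (0 : ℝ), F (-t) := by
    simp
  rw [← intervalIntegral.integral_Iic_add_Ioi hFint.integrableOn hFint.integrableOn, hneg,
    ← integral_add hFint.comp_neg.integrableOn hFint.integrableOn]
  calc ∫ t in Set.Ioi (0 : ℝ), (F (-t) + F t)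
      = ∫ t in Set.Ioi (0 : ℝ), 2 * K (2 * Real.pi * t) := by
        refine setIntegral_congr_fun measurableSet_Ioi fun t ht => ?_
        simp only [hF, hK, mul_neg, heven]
        rw [← add_mul, add_comm, fourier_indicator_Icc_add_neg hab.le (ne_of_gt ht), mul_assoc]
    _ = _ := by
        rw [integral_const_mul, integral_comp_mul_left_Ioi K 0 (by positivity), mul_zero,
          Complex.real_smul]
        push_cast
        field_simp

/-- **Expected shortfall by Fourier inversion.**
If `Y` is an integrable real random variable, symmetric about the origin, whose
characteristic function `φ_Y` is integrable on `ℝ`, `α ∈ (1/2, 1)` and `a` is an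
`α`-quantile (`P(Y ≤ a) = α`), then the expected shortfall
`ES_α(Y) = E[Y 1_{Y ≥ a}]/(1-α)` equals the limit, as `b → ∞`, of
`(1/(π(1-α))) ∫₀^∞ ((b s sin(b s) + cos(b s) - a s sin(a s) - cos(a s))/s²) φ_Y(s) ds`. -/
theorem expected_shortfall_fourier_limit
    {Ω : Type*} [MeasurableSpace Ω] (μ : Measure Ω) [IsProbabilityMeasure μ]
    (Y : Ω → ℝ) (hY : Measurable Y) (hYint : Integrable Y μ)
    (φY : ℝ → ℂ)
    (hφY : ∀ s : ℝ, φY s = ∫ ω, Complex.exp (Complex.I * (s * Y ω)) ∂μ)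
    (hsymm : Measure.map Y μ = Measure.map (fun ω => -Y ω) μ)
    (hint : Integrable φY)
    (α : ℝ) (hα : α ∈ Set.Ioo (1 / 2 : ℝ) 1)
    (a : ℝ) (ha : μ {ω | Y ω ≤ a} = ENNReal.ofReal α) :
    Tendsto
      (fun b : ℝ => (1 / (Real.pi * (1 - α)) : ℂ) * ∫ s in Set.Ioi (0 : ℝ),
        (((b * s * Real.sin (b * s) + Real.cos (b * s)
            - a * s * Real.sin (a * s) - Real.cos (a * s)) / s ^ 2 : ℝ) : ℂ) * φY s)
      atTop
      (nhds (((1 / (1 - α)) * ∫ ω, Set.indicator {ω | a ≤ Y ω} Y ω ∂μ : ℝ) : ℂ)) := by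
  have hα1 : (1 : ℂ) - α ≠ 0 := by
    rw [sub_ne_zero]
    exact_mod_cast hα.2.ne'
  set ν := μ.map Y with hν
  have : IsProbabilityMeasure ν := Measure.isProbabilityMeasure_map hY.aemeasurable
  have hφ : φY = charFun ν := by
    ext s
    rw [hφY, charFun_apply_real, hν, integral_map hY.aemeasurable (by fun_prop)]
    refine integral_congr_ae (ae_of_all _ fun ω => ?_)
    simp only [mul_comm]
  have heven : ∀ s, charFun ν (-s) = charFun ν s := fun s => by
    conv_rhs => rw [hsymm]
    rw [charFun_apply_real, charFun_apply_real, integral_map hY.aemeasurable (by fun_prop),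
      integral_map (φ := fun ω => -Y ω) hY.neg.aemeasurable (by fun_prop)]
    simp
  have hνint : Integrable (fun x : ℝ => x) ν :=
    (integrable_map_measure (by fun_prop) hY.aemeasurable).2 hYint
  have hES : ∫ ω, Set.indicator {ω | a ≤ Y ω} Y ω ∂μ = ∫ x in Set.Ici a, x ∂ν := by
    rw [← integral_indicator measurableSet_Ici, hν, integral_map hY.aemeasurable
      (measurable_id'.indicator measurableSet_Ici).aestronglyMeasurable]
    rfl
  have hlim : Tendsto (fun b => ∫ x in Set.Icc a b, x ∂ν) atTop
      (nhds (∫ x in Set.Ici a, x ∂ν)) := by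
    have hcover := (aecover_Iic (μ := ν.restrict (Set.Ici a))
      tendsto_id).integral_tendsto_of_countably_generated hνint.integrableOn
    refine hcover.congr fun b => ?_
    rw [Measure.restrict_restrict measurableSet_Iic, Set.inter_comm, Set.Ici_inter_Iic]
    rfl
  subst hφ
  rw [hES]
  refine ((Complex.continuous_ofReal.tendsto _).comp (hlim.const_mul (1 / (1 - α)))).congr' ?_
  filter_upwards [eventually_gt_atTop a] with b hb
  simp only [Function.comp_apply, Complex.ofReal_mul,
    setIntegral_Icc_id_eq_integral_charFun ν hint heven hb]
  rw [← mul_assoc]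
  congr 1
  push_cast
  field_simp
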